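/- For all natural numbers M and k with k < M and every real β with 0 < β < 1, the function e ↦ ∑_{j=0}^{k} C(M,j)·e^j·(1−e)^{M−j} is strictly decreasing on [0,1], takes the value 1 at e = 0 and the value 0 at e = 1, and there exists a unique e* ∈ (0,1) with ∑_{j=0}^{k} C(M,j)·(e*)^j·(1−e*)^{M−j} = β; moreover Bin̄(k, M, β) = e*, so the supremum in the binomial tail inversion is attained and satisfies Bin_cdf(k, M, Bin̄(k, M, β)) = β. -/

import Mathlib

open scoped BigOperators

/-- The binomial CDF: `Bin_cdf(k, M, e) = ∑_{j=0}^{k} C(M,j)·e^j·(1−e)^{M−j}`. -/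
noncomputable def binCdf (k M : ℕ) (e : ℝ) : ℝ :=
  ∑ j ∈ Finset.range (k + 1), (M.choose j : ℝ) * e ^ j * (1 - e) ^ (M - j)

/-- The binomial tail inversion `Bin̄(k, M, β)`. -/
noncomputable def binInv (k M : ℕ) (β : ℝ) : ℝ :=
  sSup {e : ℝ | e ∈ Set.Icc (0:ℝ) 1 ∧ β ≤ binCdf k M e}

theorem binCdf_hasDerivAt (M k : ℕ) (hk : k < M) (e : ℝ) :
    HasDerivAt (fun e => binCdf k M e)
      (-((M.choose (k + 1) : ℝ) * (k + 1) * e ^ k * (1 - e) ^ (M - (k + 1)))) e := by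
  have hpow : ∀ n : ℕ, HasDerivAt (fun x : ℝ => (1 - x) ^ n) (-(n * (1 - e) ^ (n - 1))) e := by
    intro n
    have h := ((hasDerivAt_id e).const_sub 1).pow n
    refine h.congr_deriv ?_
    simp
  induction k with
  | zero =>
    have h := hpow M
    simp only [binCdf]
    simpa using h
  | succ k ih =>
    have h1 := ih (by omega)
    obtain ⟨n, rfl⟩ : ∃ n, M = n + 1 + (k + 1) := ⟨M - (k + 2), by omega⟩
    have h2 := ((((hasDerivAt_pow (k + 1) e)).const_mul
      ((n + 1 + (k + 1)).choose (k + 1) : ℝ))).mul (hpow (n + 1))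
    have h3 := h1.add h2
    have hc : ((n + 1 + (k + 1)).choose (k + 1 + 1) : ℝ) * (k + 1 + 1)
        = ((n + 1 + (k + 1)).choose (k + 1) : ℝ) * (n + 1) := by
      have := Nat.choose_succ_right_eq (n + 1 + (k + 1)) (k + 1)
      rw [Nat.add_sub_cancel] at this
      exact_mod_cast this
    have e1 : n + 1 + (k + 1) - (k + 1) = n + 1 := by omega
    have e2 : n + 1 + (k + 1) - (k + 1 + 1) = n := by omega
    have hf : (fun e => binCdf (k + 1) (n + 1 + (k + 1)) e) =
        (fun e => binCdf k (n + 1 + (k + 1)) e) +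
        ((fun e => ((n + 1 + (k + 1)).choose (k + 1) : ℝ) * e ^ (k + 1)) *
          fun x : ℝ => (1 - x) ^ (n + 1)) := by
      funext x
      simp only [binCdf, Pi.add_apply, Pi.mul_apply]
      rw [Finset.sum_range_succ _ (k + 1), e1]
    rw [hf]
    refine h3.congr_deriv ?_
    rw [e1, e2]
    push_cast
    rw [hc]
    ring

/-- For `k < M` and `0 < β < 1`: the binomial CDF `e ↦ Bin_cdf(k, M, e)` is strictly
decreasing on `[0,1]`, equals `1` at `e = 0` and `0` at `e = 1`, there is a unique
`e* ∈ (0,1)` with `Bin_cdf(k, M, e*) = β`, the binomial tail inversion equals `e*`,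
and hence the supremum is attained: `Bin_cdf(k, M, Bin̄(k, M, β)) = β`. -/
theorem binCdf_strictAnti_and_binInv_attained (M k : ℕ) (hk : k < M)
    (β : ℝ) (hβ0 : 0 < β) (hβ1 : β < 1) :
    StrictAntiOn (fun e => binCdf k M e) (Set.Icc (0:ℝ) 1) ∧
    binCdf k M 0 = 1 ∧
    binCdf k M 1 = 0 ∧
    ∃ e : ℝ, e ∈ Set.Ioo (0:ℝ) 1 ∧ binCdf k M e = β ∧
      (∀ e' ∈ Set.Ioo (0:ℝ) 1, binCdf k M e' = β → e' = e) ∧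
      binInv k M β = e ∧
      binCdf k M (binInv k M β) = β := by
  have hd := binCdf_hasDerivAt M k hk
  have hcont : ContinuousOn (fun e => binCdf k M e) (Set.Icc (0:ℝ) 1) :=
    fun x _ => (hd x).continuousAt.continuousWithinAt
  have hanti : StrictAntiOn (fun e => binCdf k M e) (Set.Icc (0:ℝ) 1) := by
    apply strictAntiOn_of_deriv_neg (convex_Icc 0 1) hcont
    intro x hx
    rw [interior_Icc] at hx
    rw [(hd x).deriv]
    have h0 : 0 < x := hx.1
    have h1 : 0 < 1 - x := by linarith [hx.2]
    have hc : (0 : ℝ) < (M.choose (k + 1) : ℝ) := by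
      exact_mod_cast Nat.choose_pos (by omega)
    have : 0 < (M.choose (k + 1) : ℝ) * (k + 1) * x ^ k * (1 - x) ^ (M - (k + 1)) := by
      positivity
    linarith
  have hz : binCdf k M 0 = 1 := by
    unfold binCdf
    rw [Finset.sum_range_succ']
    simp
  have ho : binCdf k M 1 = 0 := by
    unfold binCdf
    apply Finset.sum_eq_zero
    intro j hj
    have : j < k + 1 := Finset.mem_range.1 hj
    rw [sub_self, zero_pow (by omega), mul_zero]
  refine ⟨hanti, hz, ho, ?_⟩
  obtain ⟨e, he, heq⟩ : β ∈ (fun e => binCdf k M e) '' Set.Ioo (0:ℝ) 1 := by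
    apply intermediate_value_Ioo' zero_le_one hcont
    simp only [hz, ho]
    exact ⟨hβ0, hβ1⟩
  have heq' : binCdf k M e = β := heq
  have heI := Set.Ioo_subset_Icc_self he
  have hinv : binInv k M β = e := by
    apply IsGreatest.csSup_eq
    refine ⟨⟨heI, heq'.ge⟩, ?_⟩
    rintro x ⟨hx, hxβ⟩
    by_contra! hlt
    have : binCdf k M x < binCdf k M e := hanti heI hx hlt
    linarith
  refine ⟨e, he, heq', ?_, hinv, by rw [hinv, heq']⟩
  intro x hx hxβ
  exact hanti.injOn (Set.Ioo_subset_Icc_self hx) heI (hxβ.trans heq'.symm)
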